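/- Let S_{u1} and S_{u2} be subspaces of F_q^k of dimensions u1 and u2 with S_{u1} ∩ S_{u2} = {0}, and let t1, t2, j be integers with 0 ≤ t1 ≤ u1, 0 ≤ t2 ≤ u2 and 0 ≤ j ≤ k. Then the number of j-dimensional F_q-subspaces V of F_q^k with dim(V ∩ S_{u1}) = t1 and dim(V ∩ S_{u2}) = t2 equals ∑_{t=0}^{t'} q^{(u1+u2−t−t1−t2)(j−t−t1−t2)} · N_t · [k−u1−u2, j−t−t1−t2]_q, where t' = min(u1 − t1, u2 − t2), N_t = (q^t − 1)(q^t − q)⋯(q^t − q^{t−1}) · [u1−t1, t]_q [u2−t2, t]_q [u1, t1]_q [u2, t2]_q for t ≥ 1, and N_0 = [u1, t1]_q [u2, t2]_q. -/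

import Mathlib

open Matrix Module

/-- The Gaussian binomial coefficient `[n, m]_q`. -/
def gbinom (q : ℕ) (n m : ℤ) : ℕ :=
  if 0 ≤ m ∧ m ≤ n then
    (∏ i ∈ Finset.range m.toNat, (q ^ n.toNat - q ^ i)) /
      (∏ i ∈ Finset.range m.toNat, (q ^ m.toNat - q ^ i))
  else 0

theorem gbinom_of_neg_right (q : ℕ) (n : ℤ) {m : ℤ} (hm : m < 0) : gbinom q n m = 0 :=
  if_neg fun h => hm.not_ge h.1

theorem gbinom_zero_right (q n : ℕ) : gbinom q n 0 = 1 := by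
  simp [gbinom]

theorem Nat.card_subtype_eq_mul_of_fiber {α β : Type*} [Finite α] [Finite β] {p : α → Prop}
    {r : β → Prop} (f : α → β) (c : ℕ) (hf : ∀ a, p a → r (f a))
    (h : ∀ b, r b → Nat.card {a // p a ∧ f a = b} = c) :
    Nat.card {a // p a} = Nat.card {b // r b} * c := by
  have := Fintype.ofFinite {b // r b}
  let g : {a // p a} → {b // r b} := fun a => ⟨f a, hf a a.2⟩
  rw [Nat.card_congr (Equiv.sigmaFiberEquiv g).symm, Nat.card_sigma,
    Finset.sum_congr rfl (g := fun _ => c), Finset.sum_const, Finset.card_univ,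
    Nat.card_eq_fintype_card, smul_eq_mul]
  intro b _
  rw [← h b b.2]
  exact Nat.card_congr ((Equiv.subtypeEquivRight fun a => by simp [g, Subtype.ext_iff]).trans
    (Equiv.subtypeSubtypeEquivSubtypeInter p fun a => f a = b))

theorem Nat.card_subtype_eq_sum_range {α : Type*} [Finite α] {p : α → Prop}
    (g : α → ℕ) (N : ℕ) (hg : ∀ a, p a → g a < N) :
    Nat.card {a // p a} = ∑ t ∈ Finset.range N, Nat.card {a // p a ∧ g a = t} := by
  let f : {a // p a} → Fin N := fun a => ⟨g a, hg a a.2⟩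
  rw [Nat.card_congr (Equiv.sigmaFiberEquiv f).symm, Nat.card_sigma,
    ← Fin.sum_univ_eq_sum_range (fun t => Nat.card {a // p a ∧ g a = t})]
  refine Finset.sum_congr rfl fun t _ => ?_
  exact Nat.card_congr ((Equiv.subtypeEquivRight fun a => by simp [f, Fin.ext_iff]).trans
    (Equiv.subtypeSubtypeEquivSubtypeInter p fun a => g a = t))

theorem prod_pow_sub_pow_pos {q : ℕ} (hq : 1 < q) (m : ℕ) :
    0 < ∏ i ∈ Finset.range m, (q ^ m - q ^ i) :=
  Finset.prod_pos fun _ hi => Nat.sub_pos_of_lt (Nat.pow_lt_pow_right hq (Finset.mem_range.1 hi))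

theorem prod_pow_sub_pow_eq_zero (q : ℕ) {n m : ℕ} (h : n < m) :
    ∏ i ∈ Finset.range m, (q ^ n - q ^ i) = 0 :=
  Finset.prod_eq_zero (Finset.mem_range.2 h) (Nat.sub_self (q ^ n))

section Counting

variable {F : Type*} [Field F]
variable {E : Type*} [AddCommGroup E] [Module F E]
variable {C : Type*} [AddCommGroup C] [Module F C]

theorem finrank_map_add_finrank_inf_ker [FiniteDimensional F E] (f : E →ₗ[F] C)
    (V : Submodule F E) :
    finrank F (V.map f) + finrank F ↥(V ⊓ f.ker) = finrank F V := by
  rw [← LinearMap.finrank_range_add_finrank_ker (f ∘ₗ V.subtype), LinearMap.range_comp,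
    Submodule.range_subtype, LinearMap.ker_comp, ← Submodule.map_comap_subtype,
    Submodule.finrank_map_subtype_eq]

theorem finrank_comap_mkQ [FiniteDimensional F E] (W : Submodule F E) (V : Submodule F (E ⧸ W)) :
    finrank F (V.comap W.mkQ) = finrank F V + finrank F W := by
  have h := finrank_map_add_finrank_inf_ker W.mkQ (V.comap W.mkQ)
  rw [Submodule.map_comap_eq_of_surjective W.mkQ_surjective, Submodule.ker_mkQ,
    inf_eq_right.2 (Submodule.le_comap_mkQ W V)] at h
  exact h.symm

theorem finrank_graph [FiniteDimensional F E] [FiniteDimensional F C] (f : E →ₗ.[F] C) :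
    finrank F f.graph = finrank F f.domain := by
  have h := finrank_map_add_finrank_inf_ker (LinearMap.fst F E C) f.graph
  have hker : f.graph ⊓ (LinearMap.fst F E C).ker = ⊥ := by
    refine (Submodule.eq_bot_iff _).2 ?_
    rintro ⟨x, y⟩ ⟨hx, hx0 : x = 0⟩
    rw [f.graph_fst_eq_zero_snd hx hx0, hx0]
    rfl
  rw [hker, finrank_bot, add_zero, f.graph_map_fst_eq_domain] at h
  exact h.symm

theorem card_submodule_eq_card_quotient [FiniteDimensional F E] (Q : Submodule F E)
    (p : Submodule F E → Prop) (hp : ∀ V, p V → Q ≤ V) (j : ℕ) :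
    Nat.card {V : Submodule F E // p V ∧ finrank F V = j} =
      Nat.card {V : Submodule F (E ⧸ Q) //
        p (V.comap Q.mkQ) ∧ finrank F V + finrank F Q = j} := by
  refine (Nat.card_congr ((Equiv.subtypeEquiv
    (q := fun V : Set.Ici Q => p V.1 ∧ finrank F V.1 = j)
    (Submodule.comapMkQRelIso Q).toEquiv fun V => ?_).trans
    ((Equiv.subtypeSubtypeEquivSubtypeInter (· ∈ Set.Ici Q) fun V : Submodule F E =>
      p V ∧ finrank F V = j).trans (Equiv.subtypeEquivRight fun V =>
        and_iff_right_of_imp fun h => hp V h.1)))).symm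
  exact and_congr Iff.rfl (finrank_comap_mkQ Q V).congr_left.symm

theorem inf_map_mkQ_eq_bot_iff (Q S : Submodule F E) (V : Submodule F (E ⧸ Q)) :
    V ⊓ S.map Q.mkQ = ⊥ ↔ V.comap Q.mkQ ⊓ S = Q ⊓ S := by
  have hQ : Q ≤ V.comap Q.mkQ := Submodule.le_comap_mkQ Q V
  rw [← (Submodule.comap_injective_of_surjective Q.mkQ_surjective).eq_iff, Submodule.comap_inf,
    Submodule.comap_map_mkQ, Submodule.comap_bot, Submodule.ker_mkQ]
  constructor
  · intro h
    refine le_antisymm (le_inf ?_ inf_le_right) (inf_le_inf_right S hQ)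
    exact (inf_le_inf_left _ le_sup_right).trans h.le
  · intro h
    rw [inf_comm, sup_inf_assoc_of_le S hQ, inf_comm S, h]
    exact sup_eq_left.2 inf_le_left

variable [Fintype F]

theorem finite_submodule_of_finiteDimensional (F E : Type*) [Field F] [Fintype F]
    [AddCommGroup E] [Module F E] [FiniteDimensional F E] : Finite (Submodule F E) :=
  have := Module.finite_of_finite F (M := E)
  inferInstance

theorem card_linearIndependent_fin [FiniteDimensional F E] (m : ℕ) :
    Nat.card {s : Fin m → E // LinearIndependent F s} =
      ∏ i ∈ Finset.range m, (Fintype.card F ^ finrank F E - Fintype.card F ^ i) := by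
  have := Module.finite_of_finite F (M := E)
  rcases le_or_gt m (finrank F E) with h | h
  · rw [card_linearIndependent h, Fin.prod_univ_eq_prod_range
      (fun i => Fintype.card F ^ finrank F E - Fintype.card F ^ i)]
  · rw [prod_pow_sub_pow_eq_zero _ h]
    have : IsEmpty {s : Fin m → E // LinearIndependent F s} :=
      ⟨fun s => h.not_ge (by simpa using s.2.fintype_card_le_finrank)⟩
    exact Nat.card_of_isEmpty

theorem card_submodule_mul_prod [FiniteDimensional F E] (m : ℕ) :
    Nat.card {X : Submodule F E // finrank F X = m} *
        ∏ i ∈ Finset.range m, (Fintype.card F ^ m - Fintype.card F ^ i) =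
      ∏ i ∈ Finset.range m, (Fintype.card F ^ finrank F E - Fintype.card F ^ i) := by
  have := Module.finite_of_finite F (M := E)
  rw [← card_linearIndependent_fin]
  symm
  refine Nat.card_subtype_eq_mul_of_fiber (fun s => Submodule.span F (Set.range s)) _
    (fun s hs => by simpa using finrank_span_eq_card hs) fun X hX => ?_
  subst hX
  rw [← card_linearIndependent_fin]
  refine Nat.card_congr
    { toFun := fun s => ⟨fun i => ⟨s.1 i, s.2.2.le (Submodule.subset_span ⟨i, rfl⟩)⟩,
        LinearIndependent.of_comp X.subtype s.2.1⟩
      invFun := fun s => ⟨fun i => s.1 i, s.2.map' X.subtype X.ker_subtype, ?_⟩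
      left_inv := fun s => rfl
      right_inv := fun s => rfl }
  have h := s.2.map' X.subtype X.ker_subtype
  refine Submodule.eq_of_le_of_finrank_eq (Submodule.span_le.2 ?_) ?_
  · rintro _ ⟨i, rfl⟩
    exact (s.1 i).2
  · exact (finrank_span_eq_card h).trans (Fintype.card_fin _)

theorem card_submodule_finrank_eq [FiniteDimensional F E] (m : ℕ) :
    Nat.card {X : Submodule F E // finrank F X = m} =
      gbinom (Fintype.card F) (finrank F E : ℤ) (m : ℤ) := by
  have hq := Fintype.one_lt_card (α := F)
  have h := card_submodule_mul_prod (F := F) (E := E) m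
  by_cases hm : m ≤ finrank F E
  · rw [gbinom, if_pos (by omega)]
    simp only [Int.toNat_natCast]
    exact (Nat.div_eq_of_eq_mul_left (prod_pow_sub_pow_pos hq m) h.symm).symm
  · rw [gbinom, if_neg (by omega)]
    rw [prod_pow_sub_pow_eq_zero _ (not_le.1 hm)] at h
    exact (mul_eq_zero.1 h).resolve_right (prod_pow_sub_pow_pos hq m).ne'

theorem card_submodule_le_finrank_eq [FiniteDimensional F E] (S : Submodule F E) (m : ℕ) :
    Nat.card {X : Submodule F E // X ≤ S ∧ finrank F X = m} =
      gbinom (Fintype.card F) (finrank F S : ℤ) (m : ℤ) := by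
  rw [← card_submodule_finrank_eq]
  refine Nat.card_congr (Equiv.symm ?_)
  refine (Equiv.subtypeEquiv (q := fun X => finrank F X.1 = m)
    (Submodule.mapIic S).toEquiv fun X => ?_).trans
    (Equiv.subtypeSubtypeEquivSubtypeInter (· ∈ Set.Iic S) fun X => finrank F X = m)
  exact ((Submodule.finrank_map_subtype_eq S X).congr_left).symm

theorem gbinom_mul_prod (F : Type*) [Field F] [Fintype F] (n m : ℕ) :
    gbinom (Fintype.card F) n m *
        ∏ i ∈ Finset.range m, (Fintype.card F ^ m - Fintype.card F ^ i) =
      ∏ i ∈ Finset.range m, (Fintype.card F ^ n - Fintype.card F ^ i) := by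
  have h := card_submodule_mul_prod (F := F) (E := Fin n → F) m
  rwa [card_submodule_finrank_eq, finrank_fin_fun] at h

/-- Submodules of `E × C` meeting `0 × C` trivially are the graphs of partially defined
linear maps. -/
noncomputable def linearPMapEquivGraph (F E C : Type*) [Field F] [AddCommGroup E] [Module F E]
    [AddCommGroup C] [Module F C] :
    (E →ₗ.[F] C) ≃ {X : Submodule F (E × C) // ∀ x ∈ X, x.1 = 0 → x.2 = 0} :=
  Equiv.ofBijective (fun f => ⟨f.graph, fun _ hx h => f.graph_fst_eq_zero_snd hx h⟩)
    ⟨fun _ _ h => LinearPMap.eq_of_eq_graph (Subtype.ext_iff.1 h),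
      fun X => ⟨X.1.toLinearPMap, Subtype.ext (X.1.toLinearPMap_graph_eq X.2)⟩⟩

theorem finite_linearPMap [FiniteDimensional F E] [FiniteDimensional F C] :
    Finite (E →ₗ.[F] C) :=
  have := finite_submodule_of_finiteDimensional F (E × C)
  Finite.of_equiv _ (linearPMapEquivGraph F E C).symm

/-- Partially defined linear maps with domain `D` are linear maps on `D`. -/
def linearPMapDomainEquiv (D : Submodule F E) :
    {f : E →ₗ.[F] C // f.domain = D} ≃ (D →ₗ[F] C) where
  toFun f := f.1.toFun ∘ₗ (LinearEquiv.ofEq D f.1.domain f.2.symm).toLinearMap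
  invFun g := ⟨⟨D, g⟩, rfl⟩
  left_inv := by
    rintro ⟨⟨D', g⟩, rfl⟩
    rfl
  right_inv _ := rfl

theorem card_linearMap [FiniteDimensional F E] [FiniteDimensional F C] :
    Nat.card (E →ₗ[F] C) = Fintype.card F ^ (finrank F C * finrank F E) := by
  rw [Module.natCard_eq_pow_finrank (K := F), Module.finrank_linearMap, Nat.card_eq_fintype_card,
    mul_comm]

theorem card_injective_linearMap [FiniteDimensional F E] [FiniteDimensional F C] :
    Nat.card {f : E →ₗ[F] C // Function.Injective f} =
      ∏ i ∈ Finset.range (finrank F E), (Fintype.card F ^ finrank F C - Fintype.card F ^ i) := by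
  rw [← card_linearIndependent_fin]
  let b := Module.finBasis F E
  refine Nat.card_congr ((b.constr F).toEquiv.subtypeEquiv fun v => ?_).symm
  have hv : v = b.constr F v ∘ b := by
    ext i
    simp
  constructor
  · intro h
    exact b.injective_constr_of_linearIndependent (R₂ := F) h
  · intro h
    rw [hv]
    exact b.linearIndependent.map' _ (LinearMap.ker_eq_bot.2 h)

theorem card_submodule_prod_disjoint_snd [FiniteDimensional F E] [FiniteDimensional F C] (m : ℕ) :
    Nat.card {X : Submodule F (E × C) // (∀ x ∈ X, x.1 = 0 → x.2 = 0) ∧ finrank F X = m} =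
      gbinom (Fintype.card F) (finrank F E : ℤ) (m : ℤ) * Fintype.card F ^ (finrank F C * m) := by
  have := finite_linearPMap (F := F) (E := E) (C := C)
  have := finite_submodule_of_finiteDimensional F E
  rw [← card_submodule_finrank_eq]
  trans Nat.card {f : E →ₗ.[F] C // finrank F f.domain = m}
  · refine Nat.card_congr (Equiv.symm ?_)
    refine (Equiv.subtypeEquiv (q := fun X : {X : Submodule F (E × C) // _} => finrank F X.1 = m)
      (linearPMapEquivGraph F E C) fun f => ?_).trans
      (Equiv.subtypeSubtypeEquivSubtypeInter _ fun X : Submodule F (E × C) => finrank F X = m)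
    exact (finrank_graph f).congr_left.symm
  · refine Nat.card_subtype_eq_mul_of_fiber (fun f => f.domain) _ (fun _ h => h) ?_
    rintro D rfl
    rw [← card_linearMap, ← Nat.card_congr (linearPMapDomainEquiv D)]
    exact Nat.card_congr (Equiv.subtypeEquivRight fun f => and_iff_right_of_imp fun h => by rw [h])

theorem card_submodule_prod_disjoint_both [FiniteDimensional F E] [FiniteDimensional F C]
    (m : ℕ) :
    Nat.card {X : Submodule F (E × C) // ((∀ x ∈ X, x.1 = 0 → x.2 = 0) ∧
        ∀ x ∈ X, x.2 = 0 → x.1 = 0) ∧ finrank F X = m} =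
      gbinom (Fintype.card F) (finrank F E : ℤ) (m : ℤ) *
        ∏ i ∈ Finset.range m, (Fintype.card F ^ finrank F C - Fintype.card F ^ i) := by
  have := finite_linearPMap (F := F) (E := E) (C := C)
  have := finite_submodule_of_finiteDimensional F E
  rw [← card_submodule_finrank_eq]
  trans Nat.card {f : E →ₗ.[F] C // Function.Injective f.toFun ∧ finrank F f.domain = m}
  · refine Nat.card_congr (Equiv.symm ?_)
    refine (Equiv.subtypeEquiv
      (q := fun X => (∀ x ∈ X.1, x.2 = 0 → x.1 = 0) ∧ finrank F X.1 = m)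
      (linearPMapEquivGraph F E C) fun f => ?_).trans
      ((Equiv.subtypeSubtypeEquivSubtypeInter _ fun X : Submodule F (E × C) =>
        (∀ x ∈ X, x.2 = 0 → x.1 = 0) ∧ finrank F X = m).trans
        (Equiv.subtypeEquivRight fun X => and_assoc.symm))
    refine and_congr ?_ (finrank_graph f).congr_left.symm
    rw [injective_iff_map_eq_zero]
    constructor
    · rintro h ⟨x, y⟩ hx (rfl : y = 0)
      obtain ⟨z, rfl, hz⟩ := f.mem_graph_iff.1 hx
      exact congrArg Subtype.val (h z hz)
    · intro h x hx
      exact Subtype.ext (h (x, f x) (f.mem_graph x) hx)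
  · refine Nat.card_subtype_eq_mul_of_fiber (fun f => f.domain) _ (fun _ h => h.2) ?_
    rintro D rfl
    rw [← card_injective_linearMap]
    refine Nat.card_congr (Equiv.trans ?_ (Equiv.subtypeEquiv (p := fun f =>
      Function.Injective f.1.toFun) (linearPMapDomainEquiv D) ?_))
    · refine (Equiv.subtypeEquivRight fun f => ?_).trans
        (Equiv.subtypeSubtypeEquivSubtypeInter (fun f : E →ₗ.[F] C => f.domain = D)
          fun f => Function.Injective f.toFun).symm
      constructor
      · rintro ⟨⟨h, -⟩, h'⟩
        exact ⟨h', h⟩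
      · rintro ⟨h', h⟩
        exact ⟨⟨h, by rw [h']⟩, h'⟩
    · rintro ⟨⟨D', g⟩, rfl⟩
      exact Iff.rfl

theorem card_submodule_inf_eq_bot [FiniteDimensional F E] (U : Submodule F E) (m : ℕ) :
    Nat.card {X : Submodule F E // X ⊓ U = ⊥ ∧ finrank F X = m} =
      gbinom (Fintype.card F) ((finrank F E - finrank F U : ℕ) : ℤ) (m : ℤ) *
        Fintype.card F ^ (finrank F U * m) := by
  obtain ⟨D, hD⟩ := exists_isCompl U
  have hfin : finrank F E - finrank F U = finrank F D := by
    rw [← Submodule.finrank_add_eq_of_isCompl hD, Nat.add_sub_cancel_left]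
  rw [hfin, ← card_submodule_prod_disjoint_snd]
  let e := Submodule.prodEquivOfIsCompl D U hD.symm
  refine (Nat.card_congr ((Submodule.orderIsoMapComap e).toEquiv.subtypeEquiv fun X => ?_)).symm
  refine and_congr ?_ (LinearEquiv.finrank_map_eq e X).congr_left.symm
  change _ ↔ X.map (e : (D × U) →ₗ[F] E) ⊓ U = ⊥
  rw [Submodule.eq_bot_iff]
  constructor
  · rintro h _ ⟨⟨⟨x, y⟩, hx, rfl⟩, hU⟩
    have hxU : (x : E) ∈ U := by
      simpa [e] using U.sub_mem hU y.2
    have hx0 : x = 0 := Subtype.ext (Submodule.disjoint_def.1 hD.disjoint _ hxU x.2)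
    have hy0 : y = 0 := h _ hx hx0
    simp [hx0, hy0]
  · rintro h ⟨x, y⟩ hx (rfl : x = 0)
    have hy := h (e (0, y)) ⟨⟨_, hx, rfl⟩, by simp [e]⟩
    exact congrArg Prod.snd (e.map_eq_zero_iff.1 hy)

theorem card_submodule_inf_eq [FiniteDimensional F E] {W U : Submodule F E} (hWU : W ≤ U)
    (j : ℕ) :
    Nat.card {V : Submodule F E // V ⊓ U = W ∧ finrank F V = j} =
      gbinom (Fintype.card F) ((finrank F E - finrank F U : ℕ) : ℤ) ((j : ℤ) - finrank F W) *
        Fintype.card F ^ ((finrank F U - finrank F W) * (j - finrank F W)) := by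
  have hU : finrank F (U.map W.mkQ) + finrank F W = finrank F U := by
    have h := finrank_map_add_finrank_inf_ker W.mkQ U
    rwa [Submodule.ker_mkQ, inf_eq_right.2 hWU] at h
  have hE := Submodule.finrank_quotient_add_finrank W
  rw [card_submodule_eq_card_quotient W _ (fun V h => h.ge.trans inf_le_left)]
  rcases le_or_gt (finrank F W) j with hj | hj
  · obtain ⟨m, rfl⟩ := Nat.exists_eq_add_of_le' hj
    have h := card_submodule_inf_eq_bot (U.map W.mkQ) m
    simp only [inf_map_mkQ_eq_bot_iff, inf_eq_left.2 hWU] at h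
    simp only [Nat.add_right_cancel_iff, h]
    rw [← hU, ← hE]
    congr 2
    · omega
    · omega
    · simp
  · rw [gbinom_of_neg_right _ _ (by omega), zero_mul]
    have : IsEmpty {V : Submodule F (E ⧸ W) //
        V.comap W.mkQ ⊓ U = W ∧ finrank F V + finrank F W = j} :=
      ⟨fun V => by have := V.2.2; omega⟩
    exact Nat.card_of_isEmpty

theorem card_submodule_inf_eq_bot_and [FiniteDimensional F E] {S T : Submodule F E}
    (hST : S ⊓ T = ⊥) (j : ℕ) :
    Nat.card {V : Submodule F E // (V ⊓ S = ⊥ ∧ V ⊓ T = ⊥) ∧ finrank F V = j} =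
      ∑ t ∈ Finset.range (min (finrank F S) (finrank F T) + 1),
        gbinom (Fintype.card F) (finrank F S : ℤ) (t : ℤ) *
          (∏ i ∈ Finset.range t, (Fintype.card F ^ finrank F T - Fintype.card F ^ i)) *
          (gbinom (Fintype.card F) ((finrank F E - (finrank F S + finrank F T) : ℕ) : ℤ)
              ((j : ℤ) - t) *
            Fintype.card F ^ ((finrank F S + finrank F T - t) * (j - t))) := by
  have := finite_submodule_of_finiteDimensional F E
  have := finite_submodule_of_finiteDimensional F (S × T)
  let φ : (S × T) →ₗ[F] E := S.subtype.coprod T.subtype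
  have hφ : ∀ x : S × T, φ x = x.1 + x.2 := fun x => rfl
  have hker : φ.ker = ⊥ := by
    rw [LinearMap.ker_coprod_of_disjoint_range]
    · simp
    · simpa [disjoint_iff] using hST
  have hrange : φ.range = S ⊔ T := by simp [φ, LinearMap.range_coprod]
  have hrank : finrank F φ.range = finrank F S + finrank F T := by
    rw [LinearMap.finrank_range_of_inj (LinearMap.ker_eq_bot.1 hker), finrank_prod]
  have hT : ∀ V : Submodule F E, V ⊓ T = ⊥ ↔ ∀ x ∈ V.comap φ, x.1 = 0 → x.2 = 0 := by
    intro V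
    rw [Submodule.eq_bot_iff]
    constructor
    · rintro h ⟨x, y⟩ hx (rfl : x = 0)
      exact Subtype.ext (h y ⟨by simpa [hφ] using hx, y.2⟩)
    · rintro h y ⟨hy, hyT⟩
      exact congrArg Subtype.val (h (0, ⟨y, hyT⟩) (by simpa [hφ] using hy) rfl)
  have hS : ∀ V : Submodule F E, V ⊓ S = ⊥ ↔ ∀ x ∈ V.comap φ, x.2 = 0 → x.1 = 0 := by
    intro V
    rw [Submodule.eq_bot_iff]
    constructor
    · rintro h ⟨x, y⟩ hx (rfl : y = 0)
      exact Subtype.ext (h x ⟨by simpa [hφ] using hx, x.2⟩)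
    · rintro h y ⟨hy, hyS⟩
      exact congrArg Subtype.val (h (⟨y, hyS⟩, 0) (by simpa [hφ] using hy) rfl)
  simp only [hS, hT]
  rw [Nat.card_subtype_eq_sum_range (fun V => finrank F (V.comap φ))
    (min (finrank F S) (finrank F T) + 1)]
  · refine Finset.sum_congr rfl fun t _ => ?_
    rw [← card_submodule_prod_disjoint_both]
    refine Nat.card_subtype_eq_mul_of_fiber (fun V => V.comap φ) _
      (fun V hV => ⟨hV.1.1.symm, hV.2⟩) ?_
    rintro X ⟨⟨hX1, hX2⟩, rfl⟩
    have h := card_submodule_inf_eq (LinearMap.map_le_range (f := φ) (p := X)) j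
    rw [hrank, (X.equivMapOfInjective φ (LinearMap.ker_eq_bot.1 hker)).symm.finrank_eq] at h
    rw [← h]
    refine Nat.card_congr (Equiv.subtypeEquivRight fun V => ?_)
    rw [inf_comm, ← Submodule.map_comap_eq,
      (Submodule.map_injective_of_injective (LinearMap.ker_eq_bot.1 hker)).eq_iff]
    constructor
    · rintro ⟨⟨⟨-, h⟩, -⟩, h'⟩
      exact ⟨h', h⟩
    · rintro ⟨rfl, hV⟩
      exact ⟨⟨⟨⟨hX2, hX1⟩, hV⟩, rfl⟩, rfl⟩
  · rintro V ⟨⟨h2, h1⟩, -⟩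
    refine Nat.lt_succ_of_le (le_min ?_ ?_)
    · have h := finrank_map_add_finrank_inf_ker (LinearMap.fst F S T) (V.comap φ)
      have hbot : V.comap φ ⊓ (LinearMap.fst F S T).ker = ⊥ :=
        (Submodule.eq_bot_iff _).2 fun x ⟨hx, hx1⟩ => Prod.ext hx1 (h1 x hx hx1)
      rw [hbot, finrank_bot, add_zero] at h
      exact h ▸ Submodule.finrank_le _
    · have h := finrank_map_add_finrank_inf_ker (LinearMap.snd F S T) (V.comap φ)
      have hbot : V.comap φ ⊓ (LinearMap.snd F S T).ker = ⊥ :=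
        (Submodule.eq_bot_iff _).2 fun x ⟨hx, hx2⟩ => Prod.ext (h2 x hx hx2) hx2
      rw [hbot, finrank_bot, add_zero] at h
      exact h ▸ Submodule.finrank_le _

theorem card_submodule_inf_eq_and [FiniteDimensional F E] {S T A B : Submodule F E}
    (hST : S ⊓ T = ⊥) (hA : A ≤ S) (hB : B ≤ T) (j : ℕ) :
    Nat.card {V : Submodule F E // (V ⊓ S = A ∧ V ⊓ T = B) ∧ finrank F V = j} =
      ∑ t ∈ Finset.range
          (min (finrank F S - finrank F A) (finrank F T - finrank F B) + 1),
        gbinom (Fintype.card F) ((finrank F S - finrank F A : ℕ) : ℤ) (t : ℤ) *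
          (∏ i ∈ Finset.range t,
            (Fintype.card F ^ (finrank F T - finrank F B) - Fintype.card F ^ i)) *
          (gbinom (Fintype.card F) ((finrank F E - (finrank F S + finrank F T) : ℕ) : ℤ)
              ((j : ℤ) - t - finrank F A - finrank F B) *
            Fintype.card F ^ ((finrank F S + finrank F T - t - finrank F A - finrank F B) *
              (j - t - finrank F A - finrank F B))) := by
  have hBS : B ⊓ S = ⊥ := le_bot_iff.1 (hST ▸ inf_comm S T ▸ inf_le_inf_right S hB)
  have hAT : A ⊓ T = ⊥ := le_bot_iff.1 (hST ▸ inf_le_inf_right T hA)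
  have hAB : A ⊓ B = ⊥ := le_bot_iff.1 (hAT ▸ inf_le_inf_left A hB)
  have hQS : (A ⊔ B) ⊓ S = A := by rw [sup_inf_assoc_of_le B hA, hBS, sup_bot_eq]
  have hQT : (A ⊔ B) ⊓ T = B := by rw [sup_comm, sup_inf_assoc_of_le A hB, hAT, sup_bot_eq]
  have hQ : finrank F ↥(A ⊔ B) = finrank F A + finrank F B := by
    rw [← Submodule.finrank_sup_add_finrank_inf_eq, hAB, finrank_bot, add_zero]
  have hS : finrank F (S.map (A ⊔ B).mkQ) + finrank F A = finrank F S := by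
    have h := finrank_map_add_finrank_inf_ker (A ⊔ B).mkQ S
    rwa [Submodule.ker_mkQ, inf_comm, hQS] at h
  have hT : finrank F (T.map (A ⊔ B).mkQ) + finrank F B = finrank F T := by
    have h := finrank_map_add_finrank_inf_ker (A ⊔ B).mkQ T
    rwa [Submodule.ker_mkQ, inf_comm, hQT] at h
  have hE := Submodule.finrank_quotient_add_finrank (A ⊔ B)
  have hdisj : S.map (A ⊔ B).mkQ ⊓ T.map (A ⊔ B).mkQ = ⊥ := by
    rw [inf_map_mkQ_eq_bot_iff, Submodule.comap_map_mkQ, hQT, sup_right_comm,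
      sup_eq_right.2 hA, sup_comm, sup_inf_assoc_of_le S hB, hST, sup_bot_eq]
  rw [card_submodule_eq_card_quotient (A ⊔ B) _
    (fun V h => sup_le (h.1.ge.trans inf_le_left) (h.2.ge.trans inf_le_left)), hQ]
  rcases le_or_gt (finrank F A + finrank F B) j with hj | hj
  · obtain ⟨m, rfl⟩ := Nat.exists_eq_add_of_le' hj
    have h := card_submodule_inf_eq_bot_and hdisj m
    simp only [inf_map_mkQ_eq_bot_iff, hQS, hQT] at h
    simp only [Nat.add_right_cancel_iff, h]
    rw [← Nat.eq_sub_of_add_eq hS, ← Nat.eq_sub_of_add_eq hT]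
    refine Finset.sum_congr rfl fun t _ => ?_
    congr 3
    · omega
    · push_cast
      ring
    · congr 1 <;> omega
  · have : IsEmpty {V : Submodule F (E ⧸ (A ⊔ B)) //
        (V.comap (A ⊔ B).mkQ ⊓ S = A ∧ V.comap (A ⊔ B).mkQ ⊓ T = B) ∧
          finrank F V + (finrank F A + finrank F B) = j} :=
      ⟨fun V => by have := V.2.2; omega⟩
    rw [Nat.card_of_isEmpty]
    refine (Finset.sum_eq_zero fun t _ => ?_).symm
    have hneg : (j : ℤ) - t - finrank F A - finrank F B < 0 := by omega
    rw [gbinom_of_neg_right _ _ hneg, zero_mul, mul_zero]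

theorem card_submodule_finrank_inf_eq_and [FiniteDimensional F E] {S T : Submodule F E}
    (hST : S ⊓ T = ⊥) (a b j : ℕ) :
    Nat.card {V : Submodule F E //
        (finrank F ↥(V ⊓ S) = a ∧ finrank F ↥(V ⊓ T) = b) ∧ finrank F V = j} =
      gbinom (Fintype.card F) (finrank F S : ℤ) a * gbinom (Fintype.card F) (finrank F T : ℤ) b *
      ∑ t ∈ Finset.range (min (finrank F S - a) (finrank F T - b) + 1),
        gbinom (Fintype.card F) ((finrank F S - a : ℕ) : ℤ) (t : ℤ) *
          (∏ i ∈ Finset.range t, (Fintype.card F ^ (finrank F T - b) - Fintype.card F ^ i)) *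
          (gbinom (Fintype.card F) ((finrank F E - (finrank F S + finrank F T) : ℕ) : ℤ)
              ((j : ℤ) - t - a - b) *
            Fintype.card F ^ ((finrank F S + finrank F T - t - a - b) * (j - t - a - b))) := by
  have := finite_submodule_of_finiteDimensional F E
  rw [← card_submodule_le_finrank_eq, ← card_submodule_le_finrank_eq, ← Nat.card_prod,
    ← Nat.card_congr Equiv.subtypeProdEquivProd]
  refine Nat.card_subtype_eq_mul_of_fiber (fun V => (V ⊓ S, V ⊓ T)) _
    (fun V hV => ⟨⟨inf_le_right, hV.1.1⟩, inf_le_right, hV.1.2⟩) ?_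
  rintro ⟨A, B⟩ ⟨⟨hA, rfl⟩, hB, rfl⟩
  rw [← card_submodule_inf_eq_and hST hA hB]
  refine Nat.card_congr (Equiv.subtypeEquivRight fun V => ?_)
  rw [Prod.mk.injEq]
  constructor
  · rintro ⟨⟨-, h⟩, h'⟩
    exact ⟨h', h⟩
  · rintro ⟨⟨rfl, rfl⟩, h⟩
    exact ⟨⟨⟨rfl, rfl⟩, h⟩, rfl, rfl⟩

end Counting

/-- For subspaces `S1, S2` of `F_q^k` of dimensions `u1, u2` with `S1 ∩ S2 = {0}`,
the number of `j`-dimensional subspaces `V` of `F_q^k` with `dim(V ∩ S1) = t1` and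
`dim(V ∩ S2) = t2` equals
`∑_{t=0}^{t'} q^{(u1+u2-t-t1-t2)(j-t-t1-t2)} N_t [k-u1-u2, j-t-t1-t2]_q`,
where `t' = min(u1-t1, u2-t2)` and `N_t` is as in Lemma 3 of the paper. -/
theorem stmt_10 (q k u1 u2 t1 t2 j : ℕ)
    (F : Type) [Field F] [Fintype F] (hF : Fintype.card F = q)
    (S1 S2 : Submodule F (Fin k → F))
    (h1 : Module.finrank F S1 = u1) (h2 : Module.finrank F S2 = u2)
    (hdisj : S1 ⊓ S2 = ⊥)
    (ht1 : t1 ≤ u1) (ht2 : t2 ≤ u2) (hj : j ≤ k) :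
    Nat.card {V : Submodule F (Fin k → F) //
        Module.finrank F V = j ∧
        Module.finrank F ↥(V ⊓ S1) = t1 ∧ Module.finrank F ↥(V ⊓ S2) = t2} =
      ∑ t ∈ Finset.range (min (u1 - t1) (u2 - t2) + 1),
        q ^ ((u1 + u2 - t - t1 - t2) * (j - t - t1 - t2)) *
          (if t = 0 then gbinom q u1 t1 * gbinom q u2 t2
           else (∏ s ∈ Finset.range t, (q ^ t - q ^ s)) *
             gbinom q ((u1 : ℤ) - t1) t * gbinom q ((u2 : ℤ) - t2) t *
             gbinom q u1 t1 * gbinom q u2 t2) *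
          gbinom q ((k : ℤ) - u1 - u2) ((j : ℤ) - t - t1 - t2) := by
  have hle : u1 + u2 ≤ k := by
    have h := Submodule.finrank_sup_add_finrank_inf_eq S1 S2
    rw [hdisj, finrank_bot, h1, h2] at h
    have h' := Submodule.finrank_le (S1 ⊔ S2)
    rw [finrank_fin_fun] at h'
    omega
  have h := card_submodule_finrank_inf_eq_and hdisj t1 t2 j
  rw [Nat.card_congr (Equiv.subtypeEquivRight fun V => and_comm), h, h1, h2, hF,
    finrank_fin_fun, Finset.mul_sum]
  refine Finset.sum_congr rfl fun t _ => ?_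
  have hk : ((k - (u1 + u2) : ℕ) : ℤ) = (k : ℤ) - u1 - u2 := by omega
  rw [hk]
  split_ifs with ht
  · subst ht
    rw [Nat.cast_zero, gbinom_zero_right, Finset.range_zero, Finset.prod_empty]
    ring
  · rw [← hF, ← gbinom_mul_prod F (u2 - t2) t, Nat.cast_sub ht1, Nat.cast_sub ht2]
    ring
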